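/- arXiv:1803.10517 — 4 statements merged into one kernel-verified Lean document; each statement's English description precedes it below -/
import Mathlib

section
/- Let U ⊆ ℝⁿ be an open connected set, x : U → ℝ^{n+1} a smooth immersion, and Y : U → ℝ^{n+1} a smooth map such that for every u ∈ U, Y(u) ∉ span{∂₁x(u),…,∂ₙx(u)} and ∂ᵢY(u) ∈ span{∂₁x(u),…,∂ₙx(u)} for all i. Let μ ∈ ℝ be a constant and set ᵐx = x + μ·Y. Suppose c : U → ℝ is a smooth function such that the vector field ᵐY := c·Y satisfies ∂ᵢ(ᵐY)(u) ∈ span{∂₁(ᵐx)(u),…,∂ₙ(ᵐx)(u)} for all i and all u ∈ U. Then c is constant on U. (Core of Proposition 3.1: if the affine normal of an affine parallel hypersurface ᵐx is everywhere parallel to the affine normal Y of x, then the proportionality factor c is constant.) -/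
open scoped ContDiff

/-- A vector outside a subspace has only the zero multiple inside it. -/
theorem eq_zero_of_smul_mem_of_notMem {K V : Type*} [DivisionRing K] [AddCommGroup V] [Module K V]
    {S : Submodule K V} {a : K} {v : V} (hv : v ∉ S) (h : a • v ∈ S) : a = 0 := by
  by_contra ha
  exact hv ((S.smul_mem_iff ha).1 h)

/-- Core of Proposition 3.1: if `ᵐx = x + μ·Y` (with `μ` a constant) is affine parallel
to `x` and the vector field `ᵐY = c·Y` has all its partial derivatives tangent to `ᵐx`
(so the affine normal of `ᵐx` is everywhere parallel to `Y`), then the proportionality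
factor `c` is constant on the open connected set `U`. -/
theorem stmt_1 {n : ℕ}
    (U : Set (EuclideanSpace ℝ (Fin n))) (hUopen : IsOpen U) (hUconn : IsConnected U)
    (x Y : EuclideanSpace ℝ (Fin n) → EuclideanSpace ℝ (Fin (n + 1)))
    (hx : ContDiffOn ℝ ∞ x U) (hY : ContDiffOn ℝ ∞ Y U)
    (himm : ∀ u ∈ U,
      LinearIndependent ℝ (fun i : Fin n => fderiv ℝ x u (EuclideanSpace.single i 1)))
    (htrans : ∀ u ∈ U,
      Y u ∉ Submodule.span ℝ
        (Set.range fun i : Fin n => fderiv ℝ x u (EuclideanSpace.single i 1)))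
    (hWein : ∀ u ∈ U, ∀ i : Fin n,
      fderiv ℝ Y u (EuclideanSpace.single i 1) ∈ Submodule.span ℝ
        (Set.range fun j : Fin n => fderiv ℝ x u (EuclideanSpace.single j 1)))
    (μ : ℝ) (c : EuclideanSpace ℝ (Fin n) → ℝ) (hc : ContDiffOn ℝ ∞ c U)
    (hpar : ∀ u ∈ U, ∀ i : Fin n,
      fderiv ℝ (fun v => c v • Y v) u (EuclideanSpace.single i 1) ∈
        Submodule.span ℝ
          (Set.range fun j : Fin n =>
            fderiv ℝ (fun v => x v + μ • Y v) u (EuclideanSpace.single j 1))) :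
    ∃ k : ℝ, ∀ u ∈ U, c u = k := by
  have hdc : DifferentiableOn ℝ c U := hc.differentiableOn (by simp)
  have hzero : Set.EqOn (fderiv ℝ c) 0 U := by
    intro u hu
    have hnhds := hUopen.mem_nhds hu
    have hxu : DifferentiableAt ℝ x u := (hx.differentiableOn (by simp)).differentiableAt hnhds
    have hYu : DifferentiableAt ℝ Y u := (hY.differentiableOn (by simp)).differentiableAt hnhds
    have hcu : DifferentiableAt ℝ c u := hdc.differentiableAt hnhds
    have hderiv (j : Fin n) : fderiv ℝ (fun v => x v + μ • Y v) u (EuclideanSpace.single j 1) =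
        fderiv ℝ x u (EuclideanSpace.single j 1) +
          μ • fderiv ℝ Y u (EuclideanSpace.single j 1) := by
      rw [fderiv_fun_add hxu (hYu.fun_const_smul μ), fderiv_fun_const_smul hYu]
      rfl
    have hle : Submodule.span ℝ (Set.range fun j : Fin n =>
          fderiv ℝ (fun v => x v + μ • Y v) u (EuclideanSpace.single j 1)) ≤
        Submodule.span ℝ
          (Set.range fun j : Fin n => fderiv ℝ x u (EuclideanSpace.single j 1)) := by
      refine Submodule.span_le.2 (Set.range_subset_iff.2 fun j => ?_)
      rw [hderiv j]
      exact Submodule.add_mem _ (Submodule.subset_span ⟨j, rfl⟩)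
        (Submodule.smul_mem _ μ (hWein u hu j))
    have hpartial (i : Fin n) : fderiv ℝ c u (EuclideanSpace.single i 1) = 0 := by
      refine eq_zero_of_smul_mem_of_notMem (htrans u hu) ?_
      have hmem := hle (hpar u hu i)
      rw [fderiv_fun_smul hcu hYu] at hmem
      exact (Submodule.add_mem_iff_right _ (Submodule.smul_mem _ (c u) (hWein u hu i))).1 hmem
    refine ContinuousLinearMap.coe_injective
      ((EuclideanSpace.basisFun (Fin n) ℝ).toBasis.ext fun i => ?_)
    simpa using hpartial i
  exact hUopen.exists_is_const_of_fderiv_eq_zero hUconn.isPreconnected hdc hzero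
end

section
/- Let n ≥ 1 be an integer, δ > 0, and λ, ν : Fin n → ℝ. Suppose that for every μ ∈ (−δ, δ) one has μ·λᵢ ≠ 1 and μ·νᵢ ≠ 1 for all i, and Σᵢ λᵢ/(1 − μλᵢ) = Σᵢ νᵢ/(1 − μνᵢ). Then Σᵢ λᵢᵏ = Σᵢ νᵢᵏ for every integer k ≥ 1. (The differentiation argument (4.25)–(4.27) in the proof of Theorem 1.2: equality of the resolvent-type sums on an interval forces equality of all power sums of the affine principal curvatures.) -/
open Filter Topology in
lemma tendsto_sum_pow_div_one_sub_mul {ι : Type*} [Fintype ι] (x : ι → ℝ) (m : ℕ) :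
    Tendsto (fun μ : ℝ => ∑ i, x i ^ m / (1 - μ * x i)) (𝓝[≠] 0) (𝓝 (∑ i, x i ^ m)) := by
  have h : ContinuousAt (fun μ : ℝ => ∑ i, x i ^ m / (1 - μ * x i)) 0 := by
    refine tendsto_finsetSum _ fun i _ => ?_
    exact ContinuousAt.div (by fun_prop) (by fun_prop) (by simp)
  simpa using h.tendsto.mono_left nhdsWithin_le_nhds

open Filter Topology in
lemma eventually_sum_pow_div_one_sub_mul_eq {ι : Type*} [Fintype ι] (x : ι → ℝ) (m : ℕ) :
    ∀ᶠ μ : ℝ in 𝓝[≠] 0, ∑ i, x i ^ m / (1 - μ * x i) =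
      ∑ i, x i ^ m + μ * ∑ i, x i ^ (m + 1) / (1 - μ * x i) := by
  have h : ∀ᶠ μ : ℝ in 𝓝[≠] 0, ∀ i, 1 - μ * x i ≠ 0 := by
    refine eventually_all.2 fun i => Eventually.filter_mono nhdsWithin_le_nhds ?_
    exact ContinuousAt.eventually_ne (by fun_prop) (by simp)
  filter_upwards [h] with μ hμ
  rw [Finset.mul_sum, ← Finset.sum_add_distrib]
  refine Finset.sum_congr rfl fun i _ => ?_
  have := hμ i
  field_simp
  ring

open Filter Topology in
lemma eventually_sum_pow_succ_div_one_sub_mul_eq {ι κ : Type*} [Fintype ι] [Fintype κ]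
    {x : ι → ℝ} {y : κ → ℝ} {m : ℕ}
    (h : ∀ᶠ μ : ℝ in 𝓝[≠] 0, ∑ i, x i ^ m / (1 - μ * x i) = ∑ i, y i ^ m / (1 - μ * y i)) :
    ∀ᶠ μ : ℝ in 𝓝[≠] 0,
      ∑ i, x i ^ (m + 1) / (1 - μ * x i) = ∑ i, y i ^ (m + 1) / (1 - μ * y i) := by
  have hp : ∑ i, x i ^ m = ∑ i, y i ^ m :=
    tendsto_nhds_unique_of_eventuallyEq (tendsto_sum_pow_div_one_sub_mul x m)
      (tendsto_sum_pow_div_one_sub_mul y m) h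
  filter_upwards [h, eventually_sum_pow_div_one_sub_mul_eq x m,
    eventually_sum_pow_div_one_sub_mul_eq y m, self_mem_nhdsWithin] with μ hμ hx hy h0
  rw [hx, hy, hp] at hμ
  exact mul_left_cancel₀ h0 (add_left_cancel hμ)

/-- The differentiation argument (4.25)–(4.27) in the proof of Theorem 1.2: equality of
the resolvent-type sums `Σᵢ λᵢ/(1 − μλᵢ) = Σᵢ νᵢ/(1 − μνᵢ)` for all `μ ∈ (−δ, δ)`
forces equality of all power sums `Σᵢ λᵢᵏ = Σᵢ νᵢᵏ`, `k ≥ 1`. -/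
theorem stmt_7 {n : ℕ} (hn : 1 ≤ n) (δ : ℝ) (hδ : 0 < δ) (l ν : Fin n → ℝ)
    (h1 : ∀ μ ∈ Set.Ioo (-δ) δ, ∀ i, μ * l i ≠ 1 ∧ μ * ν i ≠ 1)
    (h2 : ∀ μ ∈ Set.Ioo (-δ) δ,
      ∑ i, l i / (1 - μ * l i) = ∑ i, ν i / (1 - μ * ν i)) :
    ∀ k : ℕ, 1 ≤ k → ∑ i, l i ^ k = ∑ i, ν i ^ k := by
  intro k hk
  have h : ∀ᶠ μ : ℝ in nhdsWithin 0 {0}ᶜ,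
      ∑ i, l i ^ k / (1 - μ * l i) = ∑ i, ν i ^ k / (1 - μ * ν i) := by
    induction k, hk using Nat.le_induction with
    | base =>
      filter_upwards [mem_nhdsWithin_of_mem_nhds (Ioo_mem_nhds (neg_lt_zero.2 hδ) hδ)] with μ hμ
      simpa using h2 μ hμ
    | succ m _ ih => exact eventually_sum_pow_succ_div_one_sub_mul_eq ih
  exact tendsto_nhds_unique_of_eventuallyEq (tendsto_sum_pow_div_one_sub_mul l k)
    (tendsto_sum_pow_div_one_sub_mul ν k) h
end

section
/- Let n ≥ 1, δ > 0, let S be a nonempty set, and let λ : S → Fin n → ℝ be such that for every u ∈ S the tuple λ(u) is nondecreasing (λ(u)₁ ≤ … ≤ λ(u)ₙ) and μ·λ(u)ᵢ ≠ 1 for all i and all μ ∈ (−δ, δ). Suppose that for each μ ∈ (−δ, δ) the value Σᵢ λ(u)ᵢ/(1 − μλ(u)ᵢ) is independent of u ∈ S. Then λ(u) is independent of u ∈ S, i.e. λ(u) = λ(u') for all u, u' ∈ S. (Analytic core of Theorem 1.2: if each equiaffine parallel hypersurface ᵐx, μ ∈ (−δ,δ), has constant affine mean curvature, then the sorted affine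 principal curvatures λ₁ ≤ … ≤ λₙ of x are constant.) -/
/-- Two finite families whose products `∏ (1 - z * aᵢ)` have nowhere vanishing factors and equal
logarithmic derivatives on an interval around `0` have equal products on that interval. -/
lemma prod_one_sub_eq_of_sum_div_eq {ι : Type*} [Fintype ι] {δ : ℝ} (a b : ι → ℝ)
    (ha : ∀ i, ∀ μ ∈ Set.Ioo (-δ) δ, μ * a i ≠ 1) (hb : ∀ i, ∀ μ ∈ Set.Ioo (-δ) δ, μ * b i ≠ 1)
    (hsum : ∀ μ ∈ Set.Ioo (-δ) δ, ∑ i, a i / (1 - μ * a i) = ∑ i, b i / (1 - μ * b i))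
    {μ : ℝ} (hμ : μ ∈ Set.Ioo (-δ) δ) :
    ∏ i, (1 - μ * a i) = ∏ i, (1 - μ * b i) := by
  have hlog (c : ι → ℝ) (hc : ∀ i, ∀ μ ∈ Set.Ioo (-δ) δ, μ * c i ≠ 1) {x : ℝ}
      (hx : x ∈ Set.Ioo (-δ) δ) :
      logDeriv (fun z : ℝ => ∏ i, (1 - z * c i)) x = -∑ i, c i / (1 - x * c i) := by
    rw [logDeriv_prod (fun i _ => sub_ne_zero.2 (hc i x hx).symm) (fun i _ => by fun_prop),
      ← Finset.sum_neg_distrib]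
    refine Finset.sum_congr rfl fun i _ => ?_
    have h : HasDerivAt (fun z : ℝ => 1 - z * c i) (-c i) x := by
      simpa using ((hasDerivAt_id x).mul_const (c i)).const_sub 1
    rw [logDeriv_apply, h.deriv, neg_div]
  have hprod (c : ι → ℝ) (hc : ∀ i, ∀ μ ∈ Set.Ioo (-δ) δ, μ * c i ≠ 1) :
      ∀ x ∈ Set.Ioo (-δ) δ, ∏ i, (1 - x * c i) ≠ 0 := fun x hx =>
    Finset.prod_ne_zero_iff.2 fun i _ => sub_ne_zero.2 (hc i x hx).symm
  obtain ⟨z, -, hz⟩ := (logDeriv_eqOn_iff (𝕜 := ℝ) (f := fun z : ℝ => ∏ i, (1 - z * a i))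
    (g := fun z : ℝ => ∏ i, (1 - z * b i)) (by fun_prop) (by fun_prop) isOpen_Ioo
    isPreconnected_Ioo (hprod b hb) (hprod a ha)).1 fun x hx => by
      rw [hlog a ha hx, hlog b hb hx, hsum x hx]
  have h0 : (0 : ℝ) ∈ Set.Ioo (-δ) δ := by
    constructor <;> linarith [hμ.1, hμ.2]
  have hz1 : z = 1 := by simpa using (hz h0).symm
  simpa [hz1] using hz hμ

/-- If `∏ (1 - z * aᵢ)` and `∏ (1 - z * bᵢ)` agree for small positive `z`, then the two families
agree as multisets. -/
lemma map_univ_eq_of_prod_one_sub_eq {ι : Type*} [Fintype ι] {δ : ℝ} (hδ : 0 < δ) (a b : ι → ℝ)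
    (h : ∀ μ ∈ Set.Ioo 0 δ, ∏ i, (1 - μ * a i) = ∏ i, (1 - μ * b i)) :
    Finset.univ.val.map a = Finset.univ.val.map b := by
  have hpoly : ∏ i, (Polynomial.X - Polynomial.C (a i)) =
      ∏ i, (Polynomial.X - Polynomial.C (b i)) := by
    refine Polynomial.eq_of_infinite_eval_eq _ _ ((Set.Ioi_infinite δ⁻¹).mono fun x hx => ?_)
    have hx0 : 0 < x := (inv_pos.2 hδ).trans hx
    have key (c : ι → ℝ) : ∏ i, (x - c i) = x ^ Fintype.card ι * ∏ i, (1 - x⁻¹ * c i) := by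
      rw [← Finset.card_univ, ← Finset.prod_const, ← Finset.prod_mul_distrib]
      refine Finset.prod_congr rfl fun i _ => ?_
      field_simp
    simp only [Set.mem_ofPred_eq, Polynomial.eval_prod, Polynomial.eval_sub, Polynomial.eval_X,
      Polynomial.eval_C]
    rw [key a, key b, h x⁻¹ ⟨inv_pos.2 hx0, inv_lt_of_inv_lt₀ hδ hx⟩]
  have hroots (c : ι → ℝ) : (∏ i, (Polynomial.X - Polynomial.C (c i))).roots =
      Finset.univ.val.map c := by
    rw [← Polynomial.roots_multiset_prod_X_sub_C (Finset.univ.val.map c), Multiset.map_map]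
    rfl
  rw [← hroots a, ← hroots b, hpoly]

/-- A monotone tuple is determined by its multiset of values. -/
lemma Monotone.eq_of_map_univ_eq {α : Type*} [PartialOrder α] {n : ℕ} {a b : Fin n → α}
    (ha : Monotone a) (hb : Monotone b)
    (h : Finset.univ.val.map a = Finset.univ.val.map b) : a = b := by
  have hperm : (List.ofFn a).Perm (List.ofFn b) := by
    simpa [Fin.univ_val_map] using h
  exact List.ofFn_injective (hperm.eq_of_sortedLE ha.sortedLE_ofFn hb.sortedLE_ofFn)

/-- Analytic core of Theorem 1.2: if for each `μ ∈ (−δ, δ)` the sum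
`Σᵢ λ(u)ᵢ/(1 − μλ(u)ᵢ)` is independent of the point `u`, and each tuple `λ(u)` is
nondecreasing, then the tuple `λ(u)` itself is independent of `u`. -/
theorem stmt_9 {n : ℕ} (hn : 1 ≤ n) (δ : ℝ) (hδ : 0 < δ) {S : Type*} [Nonempty S]
    (l : S → Fin n → ℝ) (hmono : ∀ u, Monotone (l u))
    (hne : ∀ u, ∀ i, ∀ μ ∈ Set.Ioo (-δ) δ, μ * l u i ≠ 1)
    (hsum : ∀ μ ∈ Set.Ioo (-δ) δ, ∀ u u' : S,
      ∑ i, l u i / (1 - μ * l u i) = ∑ i, l u' i / (1 - μ * l u' i)) :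
    ∀ u u' : S, l u = l u' := by
  intro u u'
  refine (hmono u).eq_of_map_univ_eq (hmono u')
    (map_univ_eq_of_prod_one_sub_eq hδ _ _ fun μ hμ => ?_)
  exact prod_one_sub_eq_of_sum_div_eq _ _ (hne u) (hne u') (fun x hx => hsum x hx u u')
    ⟨by linarith [hμ.1], hμ.2⟩
end

section
/- Let B be a real symmetric n×n matrix whose eigenvalues, sorted in nondecreasing order, are λ₁ ≤ … ≤ λₙ, let μ ∈ ℝ satisfy 1 − μλᵢ > 0 for all i, and let c > 0. Then Iₙ − μ·B is invertible, the matrix B' := c·B·(Iₙ − μ·B)⁻¹ is symmetric, and its eigenvalues sorted in nondecreasing order are cλ₁/(1 − μλ₁) ≤ … ≤ cλₙ/(1 − μλₙ). In particular, if a family u ↦ B(u) of such matrices has sorted eigenvalues independent of u, then so does the family u ↦ B'(u). (Proposition 3.5: if a locally strongly convex hypersurface has constant affine principal curvatures, then so do all of its equiaffine parallel hypersurfaces.) -/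
open Polynomial

theorem Multiset.map_eq_map_of_prod_X_sub_C_eq {ι K : Type*} [Fintype ι] [CommRing K] [IsDomain K]
    {d l : ι → K}
    (h : ∏ i, (X - C (d i)) = ∏ i, (X - C (l i))) :
    Finset.univ.val.map d = Finset.univ.val.map l := by
  have hroots (f : ι → K) : (∏ i, (X - C (f i))).roots = Finset.univ.val.map f := by
    rw [← roots_multiset_prod_X_sub_C (Finset.univ.val.map f), Multiset.map_map]
    rfl
  rw [← hroots d, ← hroots l, h]

namespace Matrix

variable {ι K : Type*} [Fintype ι] [DecidableEq ι]

theorem charpoly_mul_diagonal_mul [CommRing K] {U V : Matrix ι ι K} (hVU : V * U = 1)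
    (d : ι → K) : (U * diagonal d * V).charpoly = ∏ i, (X - C (d i)) := by
  rw [charpoly_mul_comm, ← mul_assoc, hVU, one_mul, charpoly_diagonal]

theorem one_sub_smul_mul_diagonal_mul [CommRing K] {U V : Matrix ι ι K} (hUV : U * V = 1)
    (μ : K) (d : ι → K) :
    1 - μ • (U * diagonal d * V) = U * diagonal (fun i => 1 - μ * d i) * V := by
  have h : diagonal (fun i => 1 - μ * d i) = (1 : Matrix ι ι K) - μ • diagonal d := by
    rw [← diagonal_one, ← diagonal_smul, diagonal_sub]
    rfl
  rw [h, mul_sub, sub_mul, mul_one, hUV, mul_smul_comm, smul_mul_assoc]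

theorem mul_diagonal_mul_mul [CommRing K] {U V : Matrix ι ι K} (hVU : V * U = 1)
    (d e : ι → K) :
    U * diagonal d * V * (U * diagonal e * V) = U * diagonal (fun i => d i * e i) * V := by
  rw [← diagonal_mul_diagonal]
  simp only [mul_assoc]
  rw [← mul_assoc V U, hVU, one_mul]

theorem one_sub_smul_mul_diagonal_mul_inv [Field K] {U V : Matrix ι ι K} (hUV : U * V = 1)
    (hVU : V * U = 1) (μ : K) (d : ι → K) (hd : ∀ i, 1 - μ * d i ≠ 0) :
    (1 - μ • (U * diagonal d * V)) * (U * diagonal (fun i => (1 - μ * d i)⁻¹) * V) = 1 := by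
  rw [one_sub_smul_mul_diagonal_mul hUV, mul_diagonal_mul_mul hVU]
  simp [mul_inv_cancel₀ (hd _), hUV]

theorem smul_mul_diagonal_mul_mul_inv [Field K] {U V : Matrix ι ι K} (hUV : U * V = 1)
    (hVU : V * U = 1) (μ c : K) (d : ι → K) (hd : ∀ i, 1 - μ * d i ≠ 0) :
    c • (U * diagonal d * V * (1 - μ • (U * diagonal d * V))⁻¹) =
      U * diagonal (fun i => c * d i / (1 - μ * d i)) * V := by
  rw [inv_eq_right_inv (one_sub_smul_mul_diagonal_mul_inv hUV hVU μ d hd),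
    mul_diagonal_mul_mul hVU, ← smul_mul_assoc, ← mul_smul_comm, ← diagonal_smul]
  congr 3
  ext i
  simp [div_eq_mul_inv, mul_assoc]

theorem IsHermitian.isUnit_and_isHermitian_and_charpoly_eq {B : Matrix ι ι ℝ}
    (hB : B.IsHermitian) (μ c : ℝ) (l : ι → ℝ) (hchar : B.charpoly = ∏ i, (X - C (l i)))
    (hne : ∀ i, 1 - μ * l i ≠ 0) :
    IsUnit (1 - μ • B) ∧ (c • (B * (1 - μ • B)⁻¹)).IsHermitian ∧
      (c • (B * (1 - μ • B)⁻¹)).charpoly = ∏ i, (X - C (c * l i / (1 - μ * l i))) := by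
  set d := hB.eigenvalues
  set U : Matrix ι ι ℝ := hB.eigenvectorUnitary.1
  have hUV : U * Uᴴ = 1 := Unitary.coe_mul_star_self hB.eigenvectorUnitary
  have hVU : Uᴴ * U = 1 := Unitary.coe_star_mul_self hB.eigenvectorUnitary
  have hspec : B = U * diagonal d * Uᴴ := by
    conv_lhs => rw [hB.spectral_theorem, Unitary.conjStarAlgAut_apply]
    rfl
  have hmap : Finset.univ.val.map d = Finset.univ.val.map l :=
    Multiset.map_eq_map_of_prod_X_sub_C_eq (hB.charpoly_eq.symm.trans hchar)
  have hd (i : ι) : 1 - μ * d i ≠ 0 := by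
    have hi : d i ∈ Finset.univ.val.map l := hmap ▸ Multiset.mem_map_of_mem d (Finset.mem_univ i)
    obtain ⟨j, -, hj⟩ := Multiset.mem_map.mp hi
    exact hj ▸ hne j
  clear_value U d
  subst hspec
  rw [smul_mul_diagonal_mul_mul_inv hUV hVU μ c d hd, charpoly_mul_diagonal_mul hVU]
  refine ⟨.of_mul_eq_one _ (one_sub_smul_mul_diagonal_mul_inv hUV hVU μ d hd),
    isHermitian_mul_mul_conjTranspose U (isHermitian_diagonal _), ?_⟩
  have h := congrArg (fun s => (s.map fun t => X - C (c * t / (1 - μ * t))).prod) hmap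
  simp only [Multiset.map_map] at h
  exact h

end Matrix

theorem Monotone.mul_div_one_sub_mul {α : Type*} [Preorder α] {μ c : ℝ} (hc : 0 ≤ c)
    {l : α → ℝ} (hl : Monotone l) (hpos : ∀ i, 0 < 1 - μ * l i) :
    Monotone fun i => c * l i / (1 - μ * l i) := by
  intro i j hij
  rw [div_le_div_iff₀ (hpos i) (hpos j)]
  linarith [mul_le_mul_of_nonneg_left (hl hij) hc]

/-- Proposition 3.5: if `B` is a real symmetric matrix with sorted eigenvalues
`λ₁ ≤ … ≤ λₙ` (with multiplicity, encoded by `charpoly B = ∏ᵢ (X − λᵢ)`), `1 − μλᵢ > 0`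
for all `i` and `c > 0`, then `I − μB` is invertible, `B' = c·B·(I − μB)⁻¹` is symmetric,
and its sorted eigenvalues are `cλᵢ/(1 − μλᵢ)`.  In particular, if a family `u ↦ B(u)`
of such matrices has sorted eigenvalues independent of `u`, then so does the family
`u ↦ B'(u)`. -/
theorem stmt_15 {n : ℕ} (hn : 1 ≤ n) (μ c : ℝ) (hc : 0 < c)
    (B : Matrix (Fin n) (Fin n) ℝ) (hB : B.IsHermitian)
    (l : Fin n → ℝ) (hmono : Monotone l)
    (hchar : B.charpoly = ∏ i, (X - C (l i)))
    (hpos : ∀ i, 0 < 1 - μ * l i) :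
    IsUnit (1 - μ • B) ∧
    (c • (B * (1 - μ • B)⁻¹)).IsHermitian ∧
    Monotone (fun i : Fin n => c * l i / (1 - μ * l i)) ∧
    (c • (B * (1 - μ • B)⁻¹)).charpoly =
      ∏ i, (X - C (c * l i / (1 - μ * l i))) ∧
    (∀ (S : Type) (Bfam : S → Matrix (Fin n) (Fin n) ℝ) (lfam : S → Fin n → ℝ),
      (∀ u, (Bfam u).IsHermitian) →
      (∀ u, Monotone (lfam u)) →
      (∀ u, (Bfam u).charpoly = ∏ i, (X - C (lfam u i))) →
      (∀ u i, 0 < 1 - μ * lfam u i) →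
      (∀ u u', lfam u = lfam u') →
      ∃ ν : Fin n → ℝ, Monotone ν ∧
        ∀ u, (c • (Bfam u * (1 - μ • Bfam u)⁻¹)).charpoly =
          ∏ i, (X - C (ν i))) := by
  have key (B : Matrix (Fin n) (Fin n) ℝ) (hB : B.IsHermitian) (l : Fin n → ℝ)
      (hchar : B.charpoly = ∏ i, (X - C (l i))) (hpos : ∀ i, 0 < 1 - μ * l i) :=
    hB.isUnit_and_isHermitian_and_charpoly_eq μ c l hchar fun i => (hpos i).ne'
  obtain ⟨hunit, hherm, hchar'⟩ := key B hB l hchar hpos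
  refine ⟨hunit, hherm, hmono.mul_div_one_sub_mul hc.le hpos, hchar', ?_⟩
  intro S Bfam lfam hBfam hlfam hcharfam hposfam hconst
  rcases isEmpty_or_nonempty S with _ | ⟨⟨u₀⟩⟩
  · exact ⟨0, monotone_const, isEmptyElim⟩
  · refine ⟨_, (hlfam u₀).mul_div_one_sub_mul hc.le (hposfam u₀), fun u => ?_⟩
    exact (key (Bfam u) (hBfam u) (lfam u₀) (hconst u u₀ ▸ hcharfam u) (hposfam u₀)).2.2
end
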